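/- Let d ≥ 2 and q be an odd prime power with d ≡ 0 (mod 4), or d ≡ 2 (mod 4) and q ≡ 1 (mod 4), and let A ⊆ F_q^d. Then (as inequalities of real numbers): if |A| ≥ (q^{d/2} + q)/(1 + q^{−(d−2)/2}), then SQ(A) ≤ |A|²/2 + q^{d/2}·|A|/2 − |A|²/q^{d/2} − |A|²/(2q) + q^{(d−2)/2}·|A|/2; and if |A| ≤ (q^{d/2} + q)/(1 + q^{−(d−2)/2}), then SQ(A) ≤ |A|²/2 + q^{d/2}·|A|/2 − |A|²/(2q^{d/2}) − |A|/2. -/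

import Mathlib

open Finset

/-- `‖x‖ = x₁² + ⋯ + x_d²` for `x ∈ F_q^d`. -/
def normSq {d : ℕ} {F : Type} [Field F] [Fintype F] (x : Fin d → F) : F := ∑ i, x i ^ 2

/-- `SQ(A)` : the number of pairs `(x,y) ∈ A×A` with `η(‖x−y‖) = 1`,
where `η` is the quadratic character of `F` (with `η(0) = 0`). -/
noncomputable def SQpairs {d : ℕ} {F : Type} [Field F] [Fintype F] [DecidableEq F]
    (A : Finset (Fin d → F)) : ℕ :=
  ((A ×ˢ A).filter (fun p => quadraticChar F (normSq (p.1 - p.2)) = 1)).card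

lemma addChar_sum {G M ι : Type*} [AddCommMonoid G] [CommMonoid M] (ψ : AddChar G M)
    (s : Finset ι) (f : ι → G) : ψ (∑ i ∈ s, f i) = ∏ i ∈ s, ψ (f i) := by
  induction s using Finset.cons_induction with
  | empty => simp
  | cons a s ha ih => rw [Finset.sum_cons, Finset.prod_cons, AddChar.map_add_eq_mul, ih]

section Field

variable {F : Type} [Field F] {d : ℕ}

lemma four_ne_zero_of_two_ne_zero (h2 : (2 : F) ≠ 0) : (4 : F) ≠ 0 := by
  rw [show (4 : F) = 2 * 2 by norm_num]
  exact mul_ne_zero h2 h2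

/-- The map `s ↦ -1/(4s)`, as a permutation of the field. -/
def negQuarterInv (F : Type) [Field F] (h4 : (4 : F) ≠ 0) : Equiv.Perm F :=
  Function.Involutive.toPerm (fun s => -(4 * s)⁻¹) fun s => by
    simp only [mul_neg, mul_inv, inv_neg, inv_inv, neg_neg]
    rw [← mul_assoc, inv_mul_cancel₀ h4, one_mul]

lemma negQuarterInv_apply (h4 : (4 : F) ≠ 0) (s : F) : negQuarterInv F h4 s = -(4 * s)⁻¹ := rfl

/-- The squared modulus of the Fourier transform of the indicator function of `A`. -/
noncomputable def powerSpectrum (ψ : AddChar F ℂ) (A : Finset (Fin d → F)) (ξ : Fin d → F) : ℝ :=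
  Complex.normSq (∑ x ∈ A, ψ (dotProduct ξ x))

lemma powerSpectrum_nonneg (ψ : AddChar F ℂ) (A : Finset (Fin d → F)) (ξ : Fin d → F) :
    0 ≤ powerSpectrum ψ A ξ := Complex.normSq_nonneg _

lemma powerSpectrum_zero (ψ : AddChar F ℂ) (A : Finset (Fin d → F)) :
    powerSpectrum ψ A 0 = (A.card : ℝ) ^ 2 := by
  simp [powerSpectrum, sq]

lemma sum_mul_powerSpectrum [Fintype F] (ψ : AddChar F ℂ) (A : Finset (Fin d → F))
    (g : (Fin d → F) → ℂ) :
    ∑ ξ, g ξ * (powerSpectrum ψ A ξ : ℂ) =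
      ∑ p ∈ A ×ˢ A, ∑ ξ, g ξ * ψ (dotProduct ξ (p.1 - p.2)) := by
  rw [Finset.sum_comm]
  refine Finset.sum_congr rfl fun ξ _ => ?_
  rw [← Finset.mul_sum, powerSpectrum, ← Complex.mul_conj, map_sum, Finset.sum_mul_sum,
    Finset.sum_product]
  simp_rw [← AddChar.map_neg_eq_conj, ← AddChar.map_add_eq_mul, dotProduct_sub, sub_eq_add_neg]

end Field

section GaussSums

variable {F : Type} [Field F] [Fintype F] [DecidableEq F] {d n : ℕ}

/-- The quadratic character of a finite field, with complex values. -/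
noncomputable def complexQuadraticChar (F : Type) [Field F] [Fintype F] [DecidableEq F] :
    MulChar F ℂ :=
  (quadraticChar F).ringHomComp (Int.castRingHom ℂ)

lemma complexQuadraticChar_apply (a : F) :
    complexQuadraticChar F a = ((quadraticChar F a : ℤ) : ℂ) := rfl

lemma complexQuadraticChar_sq {a : F} (ha : a ≠ 0) : complexQuadraticChar F a ^ 2 = 1 := by
  rw [complexQuadraticChar_apply]
  exact_mod_cast quadraticChar_sq_one ha

lemma complexQuadraticChar_ne_one (hF : ringChar F ≠ 2) : complexQuadraticChar F ≠ 1 :=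
  (MulChar.ringHomComp_ne_one_iff (RingHom.injective_int _)).mpr (quadraticChar_ne_one hF)

lemma sum_addChar_mul_sq (hF : ringChar F ≠ 2) {ψ : AddChar F ℂ} (hψ : ψ.IsPrimitive)
    {s : F} (hs : s ≠ 0) :
    ∑ x : F, ψ (s * x ^ 2) =
      complexQuadraticChar F s * gaussSum (complexQuadraticChar F) ψ := by
  have h1 : ∑ x : F, ψ (s * x ^ 2) =
      ∑ a : F, (complexQuadraticChar F a + 1) * ψ (s * a) := by
    rw [← Finset.sum_fiberwise (s := univ) (g := fun x : F => x ^ 2)]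
    refine Finset.sum_congr rfl fun a _ => ?_
    have hc := quadraticChar_card_sqrts hF a
    have hset : ({x : F | x ^ 2 = a} : Set F).toFinset = univ.filter (fun x => x ^ 2 = a) := by
      ext; simp
    rw [hset] at hc
    rw [Finset.sum_congr rfl (g := fun _ => ψ (s * a)) (by
      intro x hx; rw [(Finset.mem_filter.mp hx).2]), Finset.sum_const, nsmul_eq_mul,
      complexQuadraticChar_apply]
    congr 1
    exact_mod_cast hc
  have h2 : ∑ a : F, ψ (s * a) = 0 := by
    simpa [mul_comm, hs] using AddChar.sum_mulShift s hψ
  have h3 := gaussSum_mulShift (complexQuadraticChar F) ψ (Units.mk0 s hs)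
  rw [h1]
  simp only [add_mul, one_mul, Finset.sum_add_distrib, h2, add_zero]
  rw [← h3, ← mul_assoc, Units.val_mk0, ← sq, complexQuadraticChar_sq hs, one_mul]
  rfl

lemma gaussSum_mul_complexQuadraticChar (hF : ringChar F ≠ 2) (ψ : AddChar F ℂ) (t : F) :
    gaussSum (complexQuadraticChar F) ψ * complexQuadraticChar F t =
      ∑ s : F, complexQuadraticChar F s * ψ (s * t) := by
  by_cases ht : t = 0
  · subst ht
    simp only [mul_zero, AddChar.map_zero_eq_one, mul_one, MulChar.map_zero]
    exact (MulChar.sum_eq_zero_of_ne_one (complexQuadraticChar_ne_one hF)).symm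
  · rw [← gaussSum_mulShift (complexQuadraticChar F) ψ (Units.mk0 t ht), mul_comm, ← mul_assoc,
      Units.val_mk0, ← sq, complexQuadraticChar_sq ht, one_mul]
    simp [gaussSum, AddChar.mulShift_apply, mul_comm]

lemma sum_addChar_quadratic (hF : ringChar F ≠ 2) {ψ : AddChar F ℂ} (hψ : ψ.IsPrimitive)
    {s : F} (hs : s ≠ 0) (a : F) :
    ∑ x : F, ψ (s * x ^ 2 + x * a) = ψ (-(4 * s)⁻¹ * a ^ 2) *
      (complexQuadraticChar F s * gaussSum (complexQuadraticChar F) ψ) := by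
  have h2 : (2 : F) ≠ 0 := Ring.two_ne_zero hF
  have h4 := four_ne_zero_of_two_ne_zero h2
  rw [← sum_addChar_mul_sq hF hψ hs, Finset.mul_sum]
  refine Fintype.sum_equiv (Equiv.addRight (a / (2 * s))) _ _ fun x => ?_
  rw [← AddChar.map_add_eq_mul, Equiv.coe_addRight]
  congr 1
  field_simp
  ring

lemma gaussSum_pow_eq (hF : ringChar F ≠ 2) {ψ : AddChar F ℂ} (hψ : ψ.IsPrimitive)
    (hn : complexQuadraticChar F (-1) ^ n = 1) :
    gaussSum (complexQuadraticChar F) ψ ^ (2 * n) = (Fintype.card F : ℂ) ^ n := by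
  rw [pow_mul, gaussSum_sq (complexQuadraticChar_ne_one hF)
    ((quadraticChar_isQuadratic F).comp _) hψ, mul_pow, hn, one_mul]

lemma sum_addChar_normSq_add_dotProduct (hF : ringChar F ≠ 2) {ψ : AddChar F ℂ}
    (hψ : ψ.IsPrimitive) (hd : d = 2 * n) (hn : complexQuadraticChar F (-1) ^ n = 1)
    {s : F} (hs : s ≠ 0) (x : Fin d → F) :
    ∑ ξ : Fin d → F, ψ (s * normSq ξ + dotProduct ξ x) =
      (Fintype.card F : ℂ) ^ n * ψ (-(4 * s)⁻¹ * normSq x) := by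
  have h1 (ξ : Fin d → F) : ψ (s * normSq ξ + dotProduct ξ x) =
      ∏ i, ψ (s * ξ i ^ 2 + ξ i * x i) := by
    rw [← addChar_sum, Finset.sum_add_distrib, ← Finset.mul_sum]
    rfl
  simp_rw [h1]
  rw [← Fintype.prod_sum (fun i y => ψ (s * y ^ 2 + y * x i))]
  simp_rw [sum_addChar_quadratic hF hψ hs]
  rw [Finset.prod_mul_distrib, ← addChar_sum, ← Finset.mul_sum, Finset.prod_const,
    Finset.card_univ, Fintype.card_fin, mul_pow, mul_comm]
  congr 1
  rw [hd, gaussSum_pow_eq hF hψ hn, pow_mul, complexQuadraticChar_sq hs, one_pow, one_mul]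

lemma sum_addChar_dotProduct {ψ : AddChar F ℂ} (hψ : ψ.IsPrimitive) (x : Fin d → F) :
    ∑ ξ : Fin d → F, ψ (dotProduct ξ x) = if x = 0 then (Fintype.card F : ℂ) ^ d else 0 := by
  have h1 (ξ : Fin d → F) : ψ (dotProduct ξ x) = ∏ i, ψ (ξ i * x i) := by
    rw [← addChar_sum]
    rfl
  simp_rw [h1]
  rw [← Fintype.prod_sum (fun i y => ψ (y * x i))]
  simp_rw [AddChar.sum_mulShift _ hψ]
  split_ifs with hx
  · simp [hx]
  · obtain ⟨i, hi⟩ := Function.ne_iff.mp hx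
    exact Finset.prod_eq_zero (Finset.mem_univ i) (by simpa using hi)

lemma complexQuadraticChar_negQuarterInv (h2 : (2 : F) ≠ 0) (s : F) :
    complexQuadraticChar F s =
      complexQuadraticChar F (-1) * complexQuadraticChar F (-(4 * s)⁻¹) := by
  by_cases hs : s = 0
  · simp [hs, MulChar.map_zero]
  · have h : s = (-1) * (-(4 * s)⁻¹) * (2 * s) ^ 2 := by
      have h4 := four_ne_zero_of_two_ne_zero h2
      field_simp
      norm_num
    conv_lhs => rw [h]
    rw [map_mul, map_pow, complexQuadraticChar_sq (mul_ne_zero h2 hs), mul_one, map_mul]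

lemma sum_quadraticChar_normSq_mul_addChar (hF : ringChar F ≠ 2) {ψ : AddChar F ℂ}
    (hψ : ψ.IsPrimitive) (hd : d = 2 * n) (hn : complexQuadraticChar F (-1) ^ n = 1)
    (x : Fin d → F) :
    ∑ ξ : Fin d → F, complexQuadraticChar F (normSq ξ) * ψ (dotProduct ξ x) =
      (Fintype.card F : ℂ) ^ n * complexQuadraticChar F (-1) *
        complexQuadraticChar F (normSq x) := by
  have h2 : (2 : F) ≠ 0 := Ring.two_ne_zero hF
  have h4 := four_ne_zero_of_two_ne_zero h2
  have hG : gaussSum (complexQuadraticChar F) ψ ≠ 0 :=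
    gaussSum_ne_zero_of_nontrivial (by simp) (complexQuadraticChar_ne_one hF) hψ
  apply mul_left_cancel₀ hG
  calc gaussSum (complexQuadraticChar F) ψ *
        ∑ ξ : Fin d → F, complexQuadraticChar F (normSq ξ) * ψ (dotProduct ξ x)
      = ∑ ξ : Fin d → F, ∑ s : F,
          complexQuadraticChar F s * ψ (s * normSq ξ + dotProduct ξ x) := by
        rw [Finset.mul_sum]
        refine Finset.sum_congr rfl fun ξ _ => ?_
        rw [← mul_assoc, gaussSum_mul_complexQuadraticChar hF, Finset.sum_mul]
        simp_rw [AddChar.map_add_eq_mul, mul_assoc]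
    _ = ∑ s : F, (Fintype.card F : ℂ) ^ n * complexQuadraticChar F (-1) *
          (complexQuadraticChar F (negQuarterInv F h4 s) *
            ψ (negQuarterInv F h4 s * normSq x)) := by
        rw [Finset.sum_comm]
        refine Finset.sum_congr rfl fun s _ => ?_
        rw [← Finset.mul_sum, negQuarterInv_apply, complexQuadraticChar_negQuarterInv h2 s]
        by_cases hs : s = 0
        · simp [hs, MulChar.map_zero]
        · rw [sum_addChar_normSq_add_dotProduct hF hψ hd hn hs]
          ring
    _ = (Fintype.card F : ℂ) ^ n * complexQuadraticChar F (-1) *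
          ∑ u : F, complexQuadraticChar F u * ψ (u * normSq x) := by
        rw [← Finset.mul_sum, Equiv.sum_comp (negQuarterInv F h4)
          (fun u => complexQuadraticChar F u * ψ (u * normSq x))]
    _ = _ := by
        rw [← gaussSum_mul_complexQuadraticChar hF]
        ring

lemma sum_normSq_eq_zero_mul_addChar (hF : ringChar F ≠ 2) {ψ : AddChar F ℂ}
    (hψ : ψ.IsPrimitive) (hd : d = 2 * n) (hn : complexQuadraticChar F (-1) ^ n = 1)
    (x : Fin d → F) :
    (Fintype.card F : ℂ) *
        ∑ ξ : Fin d → F, (if normSq ξ = 0 then 1 else 0) * ψ (dotProduct ξ x) =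
      (Fintype.card F : ℂ) ^ d * (if x = 0 then 1 else 0) + (Fintype.card F : ℂ) ^ n *
        ((Fintype.card F : ℂ) * (if normSq x = 0 then 1 else 0) - 1) := by
  have h2 : (2 : F) ≠ 0 := Ring.two_ne_zero hF
  have h4 := four_ne_zero_of_two_ne_zero h2
  have key : ∀ t : F, (Fintype.card F : ℂ) * (if t = 0 then 1 else 0) = ∑ s : F, ψ (s * t) := by
    intro t
    rw [AddChar.sum_mulShift t hψ]
    split_ifs <;> simp
  have h0 : ∀ f : F → ℂ, ∑ s, f s = f 0 + ∑ s ∈ univ.erase 0, f s := fun f =>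
    (Finset.add_sum_erase _ f (Finset.mem_univ 0)).symm
  have hsum : ∑ s : F, ∑ ξ : Fin d → F, ψ (s * normSq ξ + dotProduct ξ x) =
      ∑ ξ : Fin d → F, ψ (dotProduct ξ x) + (Fintype.card F : ℂ) ^ n *
        ∑ s ∈ univ.erase (0 : F), ψ (negQuarterInv F h4 s * normSq x) := by
    rw [h0, Finset.mul_sum]
    congr 1
    · simp
    · refine Finset.sum_congr rfl fun s hs => ?_
      rw [sum_addChar_normSq_add_dotProduct hF hψ hd hn (Finset.ne_of_mem_erase hs),
        negQuarterInv_apply]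
  have hquarter := Equiv.sum_comp (negQuarterInv F h4) (fun u => ψ (u * normSq x))
  rw [h0, negQuarterInv_apply, ← key] at hquarter
  simp only [mul_zero, inv_zero, neg_zero, zero_mul, AddChar.map_zero_eq_one] at hquarter
  rw [Finset.mul_sum]
  simp_rw [← mul_assoc, key, Finset.sum_mul, ← AddChar.map_add_eq_mul]
  rw [Finset.sum_comm, hsum, sum_addChar_dotProduct hψ, ← key, ← hquarter]
  split_ifs <;> ring

end GaussSums

section PairSums

variable {F : Type} [Field F] [Fintype F] [DecidableEq F] {d n : ℕ}

lemma sum_powerSpectrum {ψ : AddChar F ℂ} (hψ : ψ.IsPrimitive) (A : Finset (Fin d → F)) :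
    ∑ ξ, powerSpectrum ψ A ξ = (Fintype.card F : ℝ) ^ d * A.card := by
  have h := sum_mul_powerSpectrum ψ A (fun _ => 1)
  simp only [one_mul, sum_addChar_dotProduct hψ, sub_eq_zero] at h
  rw [Finset.sum_product] at h
  have h' : ∑ x ∈ A, ∑ y ∈ A, (if x = y then (Fintype.card F : ℂ) ^ d else 0) =
      (Fintype.card F : ℂ) ^ d * A.card := by
    simp [mul_comm]
  rw [h'] at h
  exact_mod_cast h

/-- The number of pairs of elements of `A` at distance zero. -/
noncomputable def zeroPairs (A : Finset (Fin d → F)) : ℕ :=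
  ((A ×ˢ A).filter (fun p => normSq (p.1 - p.2) = 0)).card

lemma card_le_zeroPairs (A : Finset (Fin d → F)) : A.card ≤ zeroPairs A := by
  rw [← Finset.diag_card]
  refine Finset.card_le_card fun p hp => ?_
  obtain ⟨h1, h2⟩ := Finset.mem_diag.mp hp
  simp [h1, ← h2, normSq]

lemma two_mul_SQpairs (A : Finset (Fin d → F)) :
    2 * (SQpairs A : ℤ) = (A.card : ℤ) ^ 2 - zeroPairs A +
      ∑ p ∈ A ×ˢ A, quadraticChar F (normSq (p.1 - p.2)) := by
  have h : (A.card : ℤ) ^ 2 = ∑ p ∈ A ×ˢ A, 1 := by simp [sq]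
  rw [SQpairs, zeroPairs, h, Finset.card_filter, Finset.card_filter]
  push_cast
  rw [Finset.mul_sum, ← Finset.sum_sub_distrib, ← Finset.sum_add_distrib]
  refine Finset.sum_congr rfl fun p _ => ?_
  by_cases h0 : normSq (p.1 - p.2) = 0
  · simp [h0]
  · rcases quadraticChar_dichotomy h0 with h1 | h1 <;> simp [h0, h1]

lemma sum_quadraticChar_mul_powerSpectrum (hF : ringChar F ≠ 2) {ψ : AddChar F ℂ}
    (hψ : ψ.IsPrimitive) (hd : d = 2 * n) (hn : complexQuadraticChar F (-1) ^ n = 1)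
    (A : Finset (Fin d → F)) :
    ∑ ξ : Fin d → F, (quadraticChar F (normSq ξ) : ℝ) * powerSpectrum ψ A ξ =
      (Fintype.card F : ℝ) ^ n * (quadraticChar F (-1) : ℝ) *
        ((∑ p ∈ A ×ˢ A, quadraticChar F (normSq (p.1 - p.2)) : ℤ) : ℝ) := by
  have h := sum_mul_powerSpectrum ψ A (fun ξ => complexQuadraticChar F (normSq ξ))
  simp_rw [sum_quadraticChar_normSq_mul_addChar hF hψ hd hn, ← Finset.mul_sum,
    complexQuadraticChar_apply] at h
  exact_mod_cast h

lemma card_mul_sum_powerSpectrum_normSq_eq_zero (hF : ringChar F ≠ 2) {ψ : AddChar F ℂ}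
    (hψ : ψ.IsPrimitive) (hd : d = 2 * n) (hn : complexQuadraticChar F (-1) ^ n = 1)
    (A : Finset (Fin d → F)) :
    (Fintype.card F : ℝ) *
        ∑ ξ : Fin d → F, (if normSq ξ = 0 then 1 else 0) * powerSpectrum ψ A ξ =
      (Fintype.card F : ℝ) ^ d * A.card + (Fintype.card F : ℝ) ^ n *
        ((Fintype.card F : ℝ) * zeroPairs A - (A.card : ℝ) ^ 2) := by
  have h := congrArg ((Fintype.card F : ℂ) * ·)
    (sum_mul_powerSpectrum ψ A (fun ξ => if normSq ξ = 0 then 1 else 0))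
  simp only [Finset.mul_sum (A ×ˢ A)] at h
  simp_rw [sum_normSq_eq_zero_mul_addChar hF hψ hd hn] at h
  rw [Finset.sum_add_distrib, ← Finset.mul_sum, ← Finset.mul_sum, Finset.sum_sub_distrib,
    ← Finset.mul_sum] at h
  have h1 : ∑ p ∈ A ×ˢ A, (if p.1 - p.2 = 0 then (1 : ℂ) else 0) = A.card := by
    rw [Finset.sum_product]
    simp [sub_eq_zero]
  have h2 : ∑ p ∈ A ×ˢ A, (if normSq (p.1 - p.2) = 0 then (1 : ℂ) else 0) = zeroPairs A := by
    rw [zeroPairs, Finset.sum_boole]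
  have h3 : ∑ p ∈ A ×ˢ A, (1 : ℂ) = (A.card : ℂ) ^ 2 := by simp [sq]
  rw [h1, h2, h3] at h
  apply Complex.ofReal_injective
  push_cast
  rw [← h]
  simp only [apply_ite Complex.ofReal, Complex.ofReal_one, Complex.ofReal_zero]

lemma card_pow_mul_sum_quadraticChar_le (hF : ringChar F ≠ 2) {ψ : AddChar F ℂ}
    (hψ : ψ.IsPrimitive) (hd : d = 2 * n) (hn : complexQuadraticChar F (-1) ^ n = 1)
    (A : Finset (Fin d → F)) :
    (Fintype.card F : ℝ) ^ n *
        ((∑ p ∈ A ×ˢ A, quadraticChar F (normSq (p.1 - p.2)) : ℤ) : ℝ) ≤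
      (Fintype.card F : ℝ) ^ d * A.card -
        ∑ ξ : Fin d → F, (if normSq ξ = 0 then 1 else 0) * powerSpectrum ψ A ξ := by
  have h1 : ((quadraticChar F (-1) : ℤ) : ℝ) ^ 2 = 1 := by
    exact_mod_cast quadraticChar_sq_one (neg_ne_zero.mpr (one_ne_zero (α := F)))
  have h2 := sum_quadraticChar_mul_powerSpectrum hF hψ hd hn A
  rw [← sum_powerSpectrum hψ A, ← Finset.sum_sub_distrib]
  calc _ = (quadraticChar F (-1) : ℝ) *
        ∑ ξ : Fin d → F, (quadraticChar F (normSq ξ) : ℝ) * powerSpectrum ψ A ξ := by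
        rw [h2]
        linear_combination (-(Fintype.card F : ℝ) ^ n *
          ((∑ p ∈ A ×ˢ A, quadraticChar F (normSq (p.1 - p.2)) : ℤ) : ℝ)) * h1
    _ ≤ _ := by
        rw [Finset.mul_sum]
        refine Finset.sum_le_sum fun ξ _ => ?_
        have hP := powerSpectrum_nonneg ψ A ξ
        by_cases h0 : normSq ξ = 0
        · simp [h0]
        · rcases quadraticChar_dichotomy (neg_ne_zero.mpr (one_ne_zero (α := F))) with e | e <;>
          rcases quadraticChar_dichotomy h0 with e' | e' <;>
          simp [h0, e, e'] <;> linarith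

lemma sq_card_le_sum_powerSpectrum (ψ : AddChar F ℂ) (A : Finset (Fin d → F)) :
    (A.card : ℝ) ^ 2 ≤
      ∑ ξ : Fin d → F, (if normSq ξ = 0 then 1 else 0) * powerSpectrum ψ A ξ := by
  have h := Finset.single_le_sum
    (f := fun ξ : Fin d → F => (if normSq ξ = 0 then 1 else 0) * powerSpectrum ψ A ξ)
    (fun ξ _ => mul_nonneg (by split_ifs <;> norm_num) (powerSpectrum_nonneg ψ A ξ))
    (Finset.mem_univ 0)
  simpa [normSq, powerSpectrum_zero] using h

end PairSums

lemma complexQuadraticChar_neg_one_pow {F : Type} [Field F] [Fintype F] [DecidableEq F] {n : ℕ}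
    (h : Even n ∨ Fintype.card F % 4 = 1) : complexQuadraticChar F (-1) ^ n = 1 := by
  have hne : (-1 : F) ≠ 0 := neg_ne_zero.mpr one_ne_zero
  rcases h with ⟨m, rfl⟩ | h
  · rw [← two_mul, pow_mul, complexQuadraticChar_sq hne, one_pow]
  · have hs : IsSquare (-1 : F) := FiniteField.isSquare_neg_one_iff.mpr (by omega)
    rw [complexQuadraticChar_apply, (quadraticChar_one_iff_isSquare hne).mpr hs]
    simp

theorem square_distances_even_plus (q d : ℕ) (F : Type) [Field F] [Fintype F] [DecidableEq F]
    (hcard : Fintype.card F = q) (hodd : Odd q)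
    (hd : d % 4 = 0 ∨ (d % 4 = 2 ∧ q % 4 = 1)) (hd2 : 2 ≤ d)
    (A : Finset (Fin d → F)) :
    (((q : ℝ) ^ (d / 2) + q) / (1 + 1 / (q : ℝ) ^ ((d - 2) / 2)) ≤ (A.card : ℝ) →
      (SQpairs A : ℝ) ≤ (A.card : ℝ) ^ 2 / 2 + (q : ℝ) ^ (d / 2) * (A.card : ℝ) / 2 - (A.card : ℝ) ^ 2 / (q : ℝ) ^ (d / 2)
        - (A.card : ℝ) ^ 2 / (2 * q) + (q : ℝ) ^ ((d - 2) / 2) * (A.card : ℝ) / 2)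
    ∧ ((A.card : ℝ) ≤ ((q : ℝ) ^ (d / 2) + q) / (1 + 1 / (q : ℝ) ^ ((d - 2) / 2)) →
      (SQpairs A : ℝ) ≤ (A.card : ℝ) ^ 2 / 2 + (q : ℝ) ^ (d / 2) * (A.card : ℝ) / 2
        - (A.card : ℝ) ^ 2 / (2 * (q : ℝ) ^ (d / 2)) - (A.card : ℝ) / 2) := by
  obtain ⟨m, rfl⟩ : ∃ m, d = 2 * (m + 1) := ⟨d / 2 - 1, by omega⟩
  have hF : ringChar F ≠ 2 := by
    intro h
    have := FiniteField.even_card_of_char_two h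
    rw [hcard] at this
    rcases hodd with ⟨k, rfl⟩
    omega
  have hn : complexQuadraticChar F (-1) ^ (m + 1) = 1 := by
    apply complexQuadraticChar_neg_one_pow
    rw [hcard, Nat.even_iff]
    omega
  have hψ := AddChar.FiniteField.primitiveChar_to_Complex_isPrimitive F
  have hS := card_pow_mul_sum_quadraticChar_le hF hψ rfl hn A
  have hK := sq_card_le_sum_powerSpectrum (AddChar.FiniteField.primitiveChar_to_Complex F) A
  have hZ := card_mul_sum_powerSpectrum_normSq_eq_zero hF hψ rfl hn A
  have hZA : (A.card : ℝ) ≤ zeroPairs A := by exact_mod_cast card_le_zeroPairs A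
  have hSQ : 2 * (SQpairs A : ℝ) = (A.card : ℝ) ^ 2 - zeroPairs A +
      ((∑ p ∈ A ×ˢ A, quadraticChar F (normSq (p.1 - p.2)) : ℤ) : ℝ) := by
    exact_mod_cast two_mul_SQpairs A
  have hq : (0 : ℝ) < q := by exact_mod_cast hodd.pos
  have e1 : 2 * (m + 1) / 2 = m + 1 := by omega
  have e2 : (2 * (m + 1) - 2) / 2 = m := by omega
  rw [e1, e2]
  rw [hcard] at hS hZ
  generalize ((∑ p ∈ A ×ˢ A, quadraticChar F (normSq (p.1 - p.2)) : ℤ) : ℝ) = S at *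
  generalize ∑ ξ : Fin (2 * (m + 1)) → F, (if normSq ξ = 0 then 1 else 0) *
    powerSpectrum (AddChar.FiniteField.primitiveChar_to_Complex F) A ξ = K at *
  generalize (A.card : ℝ) = a at *
  generalize (zeroPairs A : ℝ) = Z at *
  generalize (SQpairs A : ℝ) = T at *
  have hqm : (0 : ℝ) < (q : ℝ) ^ m := by positivity
  have hpow : (q : ℝ) ^ (2 * (m + 1)) = ((q : ℝ) ^ m * q) ^ 2 := by ring
  rw [hpow] at hS hZ
  rw [pow_succ (q : ℝ) m] at hS hZ ⊢
  generalize (q : ℝ) ^ m = Q at *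
  have hN : 0 < Q * q := by positivity
  have hK' : a ^ 2 / (Q * q) ≤ K / (Q * q) := by gcongr
  have hS' : S ≤ Q * q * a - K / (Q * q) := by
    rw [← mul_le_mul_iff_right₀ hN]
    refine hS.trans_eq ?_
    field_simp
  have hZ' : Z = K / (Q * q) - Q * a + a ^ 2 / q := by
    field_simp
    apply mul_left_cancel₀ hq.ne'
    linear_combination -hZ
  have f1 : a ^ 2 / (2 * (Q * q)) = a ^ 2 / (Q * q) / 2 := by field_simp
  have f2 : a ^ 2 / (2 * (q : ℝ)) = a ^ 2 / q / 2 := by field_simp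
  rw [f1, f2]
  exact ⟨fun _ => by linarith, fun _ => by linarith⟩
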